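/- arXiv:2403.03973 — 9 statements merged into one kernel-verified Lean document; each statement's English description precedes it below -/
import Mathlib

section
/- Let p₁, p₂, p₃ be positive integers and q₁, q₂, q₃ integers with gcd(p_i, q_i) = 1 for each i, and assume q₁p₂p₃ + p₁q₂p₃ + p₁p₂q₃ ≠ 0. Let M be the 4×4 integer matrix with rows (1,1,1,0), (p₁,0,0,q₁), (0,p₂,0,q₂), (0,0,p₃,q₃). Set K = gcd(p₁,p₂,p₃) and L = |q₁p₂p₃ + p₁q₂p₃ + p₁p₂q₃| / K. Then the quotient of ℤ⁴ by the subgroup generated by the rows of M is isomorphic, as an abelian group, to (ℤ/Kℤ) × (ℤ/Lℤ). -/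
/-- If `c`, `g`, `d` have no common factor, then some `c + t * g` is coprime to `d`. -/
theorem Int.exists_isCoprime_add_mul {c g d : ℤ} (hg : g ≠ 0) (hd : d ≠ 0)
    (h : ∃ x y z : ℤ, x * c + y * g + z * d = 1) : ∃ t : ℤ, IsCoprime (c + t * g) d := by
  obtain ⟨x, y, z, hxyz⟩ := h
  obtain ⟨k, c', g', hk, hcg, rfl, rfl⟩ := Int.exists_gcd_one' (m := c) (n := g)
    (Int.gcd_pos_of_ne_zero_right c hg)
  have hg' : g' ≠ 0 := left_ne_zero_of_mul hg
  have hcop : IsCoprime c' (g'.natAbs : ℤ) := by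
    rw [Int.isCoprime_iff_gcd_eq_one]
    rwa [Int.gcd, Int.natAbs_natCast]
  obtain ⟨p, hpd, hp, hpc⟩ := Nat.forall_exists_prime_gt_and_zmodEq d.natAbs
    (Int.natAbs_ne_zero.2 hg') hcop
  obtain ⟨t, ht⟩ : g' ∣ (p : ℤ) - c' :=
    (Int.dvd_natAbs.2 dvd_rfl).trans hpc.symm.dvd
  refine ⟨t, ?_⟩
  have hpcop : IsCoprime (p : ℤ) d := by
    rw [Int.isCoprime_iff_gcd_eq_one, Int.gcd, Int.natAbs_natCast, ← Nat.Coprime,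
      hp.coprime_iff_not_dvd]
    exact Nat.not_dvd_of_pos_of_lt (Int.natAbs_pos.2 hd) hpd
  have hkcop : IsCoprime (k : ℤ) d := ⟨x * c' + y * g', z, by linarith⟩
  have : c' * k + t * (g' * k) = p * k := by linear_combination (-(k : ℤ)) * ht
  rw [this]
  exact hpcop.mul_left hkcop

/-- The row lattice of a nonsingular integer `2 × 2` matrix with coprime entries contains a
primitive vector. -/
theorem Int.exists_isCoprime_row_combination {a b c d : ℤ} (hD : a * d - b * c ≠ 0)
    (h : ∃ x y z w : ℤ, x * a + y * b + z * c + w * d = 1) :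
    ∃ s t : ℤ, IsCoprime (s * a + t * c) (s * b + t * d) := by
  obtain ⟨x, y, z, w, hxyzw⟩ := h
  have hpos : 0 < Int.gcd a b := by
    rw [Int.gcd_pos_iff]
    by_contra! hab
    simp [hab.1, hab.2] at hD
  obtain ⟨g, α, β, hg, hαβ, rfl, rfl⟩ := Int.exists_gcd_one' hpos
  obtain ⟨u, v, huv⟩ := Int.isCoprime_iff_gcd_eq_one.2 hαβ
  have hD' : α * d - β * c ≠ 0 := by
    intro h0
    exact hD (by linear_combination (g : ℤ) * h0)
  obtain ⟨t, m, n, ht⟩ := Int.exists_isCoprime_add_mul (c := c * u + d * v)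
    (Int.natCast_ne_zero.2 hg.ne') hD'
    ⟨z * α + w * β, x * α + y * β, w * u - z * v, by
      linear_combination hxyzw + (z * c + w * d) * huv⟩
  exact ⟨t, 1, m * u - n * β, m * v + n * α, by
    linear_combination ht + m * t * g * huv⟩

/-- Smith normal form of a `2 × 2` integer matrix `K • !![a, b; c, d]` with `a`, `b`, `c`, `d`
coprime: in the unimodular coordinates `(m x + n y, f x - e y)`, the row lattice is
`K ℤ × K (a d - b c) ℤ`. -/
theorem Int.exists_smith_coordinates {a b c d : ℤ} (K : ℤ) (hD : a * d - b * c ≠ 0)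
    (h : ∃ x y z w : ℤ, x * a + y * b + z * c + w * d = 1) :
    ∃ m n e f : ℤ, m * e + n * f = 1 ∧ ∀ x y : ℤ,
      (K ∣ m * x + n * y ∧ K * (a * d - b * c) ∣ f * x - e * y) ↔
        ∃ s t : ℤ, x = s * (K * a) + t * (K * c) ∧ y = s * (K * b) + t * (K * d) := by
  obtain ⟨s₀, t₀, m, n, hmn⟩ := Int.exists_isCoprime_row_combination hD h
  refine ⟨m, n, s₀ * a + t₀ * c, s₀ * b + t₀ * d, hmn, fun x y => ⟨?_, ?_⟩⟩
  · rintro ⟨⟨i, hi⟩, ⟨j, hj⟩⟩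
    refine ⟨s₀ * i + (n * d + m * c) * j, t₀ * i - (m * a + n * b) * j, ?_, ?_⟩
    · linear_combination (s₀ * a + t₀ * c) * hi + n * hj - x * hmn
    · linear_combination (s₀ * b + t₀ * d) * hi - m * hj - y * hmn
  · rintro ⟨s, t, rfl, rfl⟩
    exact ⟨⟨m * (s * a + t * c) + n * (s * b + t * d), by ring⟩, ⟨s * t₀ - t * s₀, by ring⟩⟩


/-- For coprime pairs (p_i,q_i) with p_i > 0 and
q₁p₂p₃ + p₁q₂p₃ + p₁p₂q₃ ≠ 0, the cokernel of the 4×4 matrix with rows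
(1,1,1,0), (p₁,0,0,q₁), (0,p₂,0,q₂), (0,0,p₃,q₃) is isomorphic to
ℤ/K × ℤ/L, where K = gcd(p₁,p₂,p₃) and L = |q₁p₂p₃ + p₁q₂p₃ + p₁p₂q₃| / K. -/
theorem stmt_1 (p₁ p₂ p₃ q₁ q₂ q₃ : ℤ)
    (hp₁ : 0 < p₁) (hp₂ : 0 < p₂) (hp₃ : 0 < p₃)
    (h₁ : Int.gcd p₁ q₁ = 1) (h₂ : Int.gcd p₂ q₂ = 1) (h₃ : Int.gcd p₃ q₃ = 1)
    (hS : q₁ * p₂ * p₃ + p₁ * q₂ * p₃ + p₁ * p₂ * q₃ ≠ 0) :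
    Nonempty
      (((Fin 4 → ℤ) ⧸ AddSubgroup.closure (Set.range
          (![![1, 1, 1, 0], ![p₁, 0, 0, q₁], ![0, p₂, 0, q₂], ![0, 0, p₃, q₃]] :
            Fin 4 → Fin 4 → ℤ))) ≃+
        (ZMod (Int.gcd p₁ (Int.gcd p₂ p₃ : ℤ)) ×
          ZMod ((q₁ * p₂ * p₃ + p₁ * q₂ * p₃ + p₁ * p₂ * q₃).natAbs /
            Int.gcd p₁ (Int.gcd p₂ p₃ : ℤ)))) := by
  obtain ⟨m₁, n₁, hmn₁⟩ := Int.isCoprime_iff_gcd_eq_one.2 h₁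
  obtain ⟨m₂, n₂, hmn₂⟩ := Int.isCoprime_iff_gcd_eq_one.2 h₂
  obtain ⟨u₁, u₂, u₃, hu⟩ : ∃ u₁ u₂ u₃ : ℤ,
      (Int.gcd p₁ (Int.gcd p₂ p₃ : ℤ) : ℤ) = u₁ * p₁ + u₂ * p₂ + u₃ * p₃ :=
    ⟨Int.gcdA p₁ (Int.gcd p₂ p₃ : ℤ), Int.gcdB p₁ (Int.gcd p₂ p₃ : ℤ) * Int.gcdA p₂ p₃,
      Int.gcdB p₁ (Int.gcd p₂ p₃ : ℤ) * Int.gcdB p₂ p₃, by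
        linear_combination Int.gcd_eq_gcd_ab p₁ (Int.gcd p₂ p₃ : ℤ) +
          Int.gcdB p₁ (Int.gcd p₂ p₃ : ℤ) * Int.gcd_eq_gcd_ab p₂ p₃⟩
  have hK : 0 < Int.gcd p₁ (Int.gcd p₂ p₃ : ℤ) := Int.gcd_pos_of_ne_zero_left _ hp₁.ne'
  have hd₁ : (Int.gcd p₁ (Int.gcd p₂ p₃ : ℤ) : ℤ) ∣ p₁ := Int.gcd_dvd_left ..
  have hd : (Int.gcd p₁ (Int.gcd p₂ p₃ : ℤ) : ℤ) ∣ (Int.gcd p₂ p₃ : ℤ) := Int.gcd_dvd_right ..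
  have hd₂ := hd.trans (Int.gcd_dvd_left p₂ p₃)
  have hd₃ := hd.trans (Int.gcd_dvd_right p₂ p₃)
  generalize Int.gcd p₁ (Int.gcd p₂ p₃ : ℤ) = K at *
  clear hd
  obtain ⟨a₁, rfl⟩ := hd₁
  obtain ⟨a₂, rfl⟩ := hd₂
  obtain ⟨a₃, rfl⟩ := hd₃
  have hK0 : (K : ℤ) ≠ 0 := Int.natCast_ne_zero.2 hK.ne'
  have hu' : u₁ * a₁ + u₂ * a₂ + u₃ * a₃ = 1 :=
    mul_left_cancel₀ hK0 (by linear_combination -hu)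
  have hS' : q₁ * (K * a₂) * (K * a₃) + K * a₁ * q₂ * (K * a₃) + K * a₁ * (K * a₂) * q₃ =
      K * (K * ((-q₂ * a₁) * (-a₃) - a₂ * (-(a₃ * q₁ + q₃ * a₁)))) := by ring
  rw [hS'] at hS ⊢
  obtain ⟨m, n, e, f, hmn, hlat⟩ := Int.exists_smith_coordinates (K : ℤ)
    (right_ne_zero_of_mul (right_ne_zero_of_mul hS))
    ⟨-u₁ * n₂, u₁ * m₂ * K * a₁ + u₂, 0, -u₃, by
      linear_combination hu' + u₁ * a₁ * hmn₂⟩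
  rw [Int.natAbs_mul, Int.natAbs_natCast, Nat.mul_div_cancel_left _ hK]
  generalize hL : (K : ℤ) * ((-q₂ * a₁) * (-a₃) - a₂ * (-(a₃ * q₁ + q₃ * a₁))) = L at hlat ⊢
  let φ : (Fin 4 → ℤ) →+ ZMod K × ZMod L.natAbs := AddMonoidHom.mk'
    (fun v => (((m * (q₁ * (v 0 - v 2) - K * a₁ * v 3) + n * (v 1 - v 2) : ℤ) : ZMod K),
      ((f * (q₁ * (v 0 - v 2) - K * a₁ * v 3) - e * (v 1 - v 2) : ℤ) : ZMod L.natAbs)))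
    (fun v w => by
      ext
      · simp only [Pi.add_apply, Prod.fst_add]
        push_cast
        ring
      · simp only [Pi.add_apply, Prod.snd_add]
        push_cast
        ring)
  have hφ : ∀ v, φ v = 0 ↔ ∃ s t : ℤ,
      q₁ * (v 0 - v 2) - K * a₁ * v 3 = s * (K * (-q₂ * a₁)) + t * (K * -(a₃ * q₁ + q₃ * a₁)) ∧
      v 1 - v 2 = s * (K * a₂) + t * (K * -a₃) := by
    intro v
    rw [← hlat, ← Int.natAbs_dvd (a := L), ← ZMod.intCast_zmod_eq_zero_iff_dvd,
      ← ZMod.intCast_zmod_eq_zero_iff_dvd]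
    exact Prod.ext_iff
  have hsurj : Function.Surjective φ := by
    rintro ⟨r, s⟩
    obtain ⟨i, rfl⟩ := ZMod.intCast_surjective r
    obtain ⟨j, rfl⟩ := ZMod.intCast_surjective s
    have hX : q₁ * (n₁ * (e * i + n * j) - 0) - K * a₁ * (-m₁ * (e * i + n * j)) =
        e * i + n * j := by
      linear_combination (e * i + n * j) * hmn₁
    refine ⟨![n₁ * (e * i + n * j), f * i - m * j, 0, -m₁ * (e * i + n * j)], Prod.ext ?_ ?_⟩
    · change ((m * (q₁ * (n₁ * (e * i + n * j) - 0) - K * a₁ * (-m₁ * (e * i + n * j))) +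
        n * (f * i - m * j - 0) : ℤ) : ZMod K) = (i : ZMod K)
      rw [hX]
      congr 1
      linear_combination i * hmn
    · change ((f * (q₁ * (n₁ * (e * i + n * j) - 0) - K * a₁ * (-m₁ * (e * i + n * j))) -
        e * (f * i - m * j - 0) : ℤ) : ZMod L.natAbs) = (j : ZMod L.natAbs)
      rw [hX]
      congr 1
      linear_combination j * hmn
  have hker : AddSubgroup.closure (Set.range
      (![![1, 1, 1, 0], ![K * a₁, 0, 0, q₁], ![0, K * a₂, 0, q₂], ![0, 0, K * a₃, q₃]] :
        Fin 4 → Fin 4 → ℤ)) = φ.ker := by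
    apply le_antisymm
    · rw [AddSubgroup.closure_le]
      rintro _ ⟨i, rfl⟩
      rw [SetLike.mem_coe, AddMonoidHom.mem_ker, hφ]
      fin_cases i
      · exact ⟨0, 0, by simp, by simp⟩
      · exact ⟨0, 0, by simp; ring, by simp⟩
      · exact ⟨1, 0, by simp; ring, by simp⟩
      · exact ⟨0, 1, by simp; ring, by simp⟩
    · intro v hv
      obtain ⟨s, t, hX, hY⟩ := (hφ v).1 hv
      have hmem := fun i => AddSubgroup.subset_closure (Set.mem_range_self (f :=
        (![![1, 1, 1, 0], ![K * a₁, 0, 0, q₁], ![0, K * a₂, 0, q₂], ![0, 0, K * a₃, q₃]] :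
          Fin 4 → Fin 4 → ℤ)) i)
      have hv' : v = (v 2 - t * (K * a₃)) • ![1, 1, 1, 0] +
          (m₁ * (v 0 - v 2 + t * (K * a₃)) + n₁ * (v 3 - s * q₂ - t * q₃)) •
            ![K * a₁, 0, 0, q₁] + s • ![0, K * a₂, 0, q₂] + t • ![0, 0, K * a₃, q₃] := by
        ext i
        fin_cases i
        · simp
          linear_combination n₁ * hX - (v 0 - v 2 + t * (K * a₃)) * hmn₁
        · simp
          linear_combination hY
        · simp
        · simp
          linear_combination -m₁ * hX - (v 3 - s * q₂ - t * q₃) * hmn₁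
      rw [hv']
      exact add_mem (add_mem (add_mem (zsmul_mem (hmem 0) _) (zsmul_mem (hmem 1) _))
        (zsmul_mem (hmem 2) _)) (zsmul_mem (hmem 3) _)
  exact ⟨(QuotientAddGroup.quotientAddEquivOfEq hker).trans
    (QuotientAddGroup.quotientKerEquivOfSurjective φ hsurj)⟩
end

section
/- Fix integers N ≥ 1, p ≥ 1, q, and ℓ. The map sending ν = (ν₁,…,ν_N) to λ = (λ₁,…,λ_{N−1}) with λ_I = ν_{I+1} − ν_I − 1 is a bijection from the set {ν ∈ ℤ^N : ν₁ < ν₂ < ⋯ < ν_N < ν₁ + p and Σ_I ν_I = ℓq} onto the set {λ ∈ ℤ^{N−1} : λ_I ≥ 0 for all I, Σ_I λ_I ≤ p − N, and Σ_{I=1}^{N−1} I·λ_I ≡ −ℓq − N(N−1)/2 (mod N)}. -/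
theorem sum_succ_sub_castSucc_sub_one (n : ℕ) (ν : Fin (n + 1) → ℤ) :
    ∑ i : Fin n, (ν i.succ - ν i.castSucc - 1) = ν (Fin.last n) - ν 0 - n := by
  induction n with
  | zero => simp
  | succ n ih =>
    have h := ih (fun i => ν i.castSucc)
    rw [Fin.sum_univ_castSucc]
    simp only [Fin.succ_castSucc, Fin.succ_last, Fin.castSucc_zero] at h ⊢
    rw [h]
    push_cast
    ring

theorem sum_weighted_succ_sub_castSucc_sub_one (n : ℕ) (ν : Fin (n + 1) → ℤ) :
    ∑ i : Fin n, (((i : ℕ) + 1 : ℕ) : ℤ) * (ν i.succ - ν i.castSucc - 1) =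
      (n + 1) * ν (Fin.last n) - ∑ i, ν i - (((n + 1) * n / 2 : ℕ) : ℤ) := by
  induction n with
  | zero => simp
  | succ n ih =>
    have h := ih (fun i => ν i.castSucc)
    have ht : (n + 1 + 1) * (n + 1) / 2 = (n + 1) * n / 2 + (n + 1) := by
      rw [show (n + 1 + 1) * (n + 1) = (n + 1) * n + (n + 1) * 2 by ring,
        Nat.add_mul_div_right _ _ two_pos]
    rw [Fin.sum_univ_castSucc, Fin.sum_univ_castSucc (f := ν), ht]
    simp only [Fin.succ_castSucc, Fin.succ_last, Fin.val_castSucc, Fin.val_last] at h ⊢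
    rw [h]
    push_cast
    ring

theorem eq_add_const_of_succ_sub_castSucc_eq {n : ℕ} {μ ν : Fin (n + 1) → ℤ}
    (h : ∀ i : Fin n, μ i.succ - μ i.castSucc - 1 = ν i.succ - ν i.castSucc - 1)
    (i : Fin (n + 1)) : μ i = ν i + (μ 0 - ν 0) := by
  induction i using Fin.induction with
  | zero => ring
  | succ i ih => linarith [h i]

theorem eq_of_succ_sub_castSucc_eq_of_sum_eq {n : ℕ} {μ ν : Fin (n + 1) → ℤ}
    (h : ∀ i : Fin n, μ i.succ - μ i.castSucc - 1 = ν i.succ - ν i.castSucc - 1)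
    (hs : ∑ i, μ i = ∑ i, ν i) : μ = ν := by
  have hc := eq_add_const_of_succ_sub_castSucc_eq h
  rw [Finset.sum_congr rfl fun i _ => hc i, Finset.sum_add_distrib] at hs
  have h0 : μ 0 - ν 0 = 0 := by
    refine (mul_eq_zero.mp ?_).resolve_left (Nat.cast_add_one_ne_zero (R := ℤ) n)
    simp only [Finset.sum_const, Finset.card_univ, Fintype.card_fin, nsmul_eq_mul] at hs
    push_cast at hs
    linarith
  funext i
  rw [hc i, h0, add_zero]

theorem exists_succ_sub_castSucc_sub_one_eq {n : ℕ} (lam : Fin n → ℤ) (k : ℤ) :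
    ∃ ν : Fin (n + 1) → ℤ, ν (Fin.last n) = k ∧
      ∀ i : Fin n, ν i.succ - ν i.castSucc - 1 = lam i := by
  let s := Fin.partialSum fun i => lam i + 1
  refine ⟨fun i => s i + (k - s (Fin.last n)), by ring, fun i => ?_⟩
  simp only [s, Fin.partialSum_succ]
  ring

theorem bijOn_succ_sub_castSucc_sub_one (n : ℕ) (p s : ℤ) :
    Set.BijOn
      (fun (ν : Fin (n + 1) → ℤ) (i : Fin n) => ν i.succ - ν i.castSucc - 1)
      {ν | StrictMono ν ∧ ν (Fin.last n) < ν 0 + p ∧ ∑ i, ν i = s}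
      {lam | (∀ i, 0 ≤ lam i) ∧ ∑ i, lam i ≤ p - ((n + 1 : ℕ) : ℤ) ∧
        Int.ModEq ((n + 1 : ℕ) : ℤ) (∑ i : Fin n, (((i : ℕ) + 1 : ℕ) : ℤ) * lam i)
          (-s - (((n + 1) * n / 2 : ℕ) : ℤ))} := by
  refine ⟨?_, ?_, ?_⟩
  · rintro ν ⟨hmono, hp, hs⟩
    refine ⟨fun i => ?_, ?_, ?_⟩
    · have := hmono (Fin.castSucc_lt_succ (i := i))
      dsimp only
      omega
    · rw [sum_succ_sub_castSucc_sub_one]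
      push_cast
      linarith
    · rw [sum_weighted_succ_sub_castSucc_sub_one, hs, Int.modEq_iff_dvd]
      exact ⟨-ν (Fin.last n), by push_cast; ring⟩
  · rintro μ ⟨-, -, hμ⟩ ν ⟨-, -, hν⟩ h
    exact eq_of_succ_sub_castSucc_eq_of_sum_eq (congrFun h) (hμ.trans hν.symm)
  · rintro lam ⟨hnonneg, hsum, hmod⟩
    obtain ⟨k, hk⟩ := Int.modEq_iff_dvd.mp hmod
    obtain ⟨ν, hlast, hν⟩ := exists_succ_sub_castSucc_sub_one_eq lam (-k)
    have hw := sum_weighted_succ_sub_castSucc_sub_one n ν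
    have hd := sum_succ_sub_castSucc_sub_one n ν
    simp only [hν] at hw hd
    refine ⟨ν, ⟨Fin.strictMono_iff_lt_succ.mpr fun i => ?_, ?_, ?_⟩, funext hν⟩
    · linarith [hν i, hnonneg i]
    · push_cast at hsum
      linarith
    · rw [hw, hlast] at hk
      push_cast at hk
      linarith

/-- The map ν ↦ λ, λ_I = ν_{I+1} − ν_I − 1 (here I : Fin (N−1)
represents the index I+1 ∈ {1,…,N−1}) is a bijection from
{ν : ν₁ < ⋯ < ν_N < ν₁ + p, Σ ν_I = ℓq} onto the set of λ ∈ ℤ^{N−1} with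
λ_I ≥ 0, Σ λ_I ≤ p − N, and Σ I·λ_I ≡ −ℓq − N(N−1)/2 (mod N). -/
theorem stmt_6 (N p : ℕ) (hN : 1 ≤ N) (hp : 1 ≤ p) (q ℓ : ℤ) :
    Set.BijOn
      (fun ν : Fin N → ℤ => fun I : Fin (N - 1) =>
        ν ⟨(I : ℕ) + 1, by have := I.isLt; omega⟩ -
          ν ⟨(I : ℕ), by have := I.isLt; omega⟩ - 1)
      {ν : Fin N → ℤ | StrictMono ν ∧
        ν ⟨N - 1, by omega⟩ < ν ⟨0, by omega⟩ + (p : ℤ) ∧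
        (∑ I, ν I) = ℓ * q}
      {lam : Fin (N - 1) → ℤ | (∀ I, 0 ≤ lam I) ∧
        (∑ I, lam I) ≤ (p : ℤ) - (N : ℤ) ∧
        Int.ModEq (N : ℤ) (∑ I : Fin (N - 1), (((I : ℕ) + 1 : ℕ) : ℤ) * lam I)
          (-(ℓ * q) - ((N * (N - 1) / 2 : ℕ) : ℤ))} := by
  obtain ⟨n, rfl⟩ := Nat.exists_eq_add_of_le' hN
  exact bijOn_succ_sub_castSucc_sub_one n p (ℓ * q)
end

section
/- Fix integers N ≥ 1, p ≥ 1, q, and ℓ with 0 ≤ ℓ ≤ N−1. Given ν = (ν₁,…,ν_N) ∈ ℤ^N, set ν₀ = ν_N − p, and let σ(I) = (I + ℓ) mod N ∈ {0,1,…,N−1}. Define λ_I = ν_{σ(I)+1} − ν_{σ(I)} − 1 for I = 1,…,N−1. This map is a bijection from the set {ν ∈ ℤ^N : ν₁ < ν₂ < ⋯ < ν_N < ν₁ + p and Σ_I ν_I = ℓq} onto the set {λ ∈ ℤ^{N−1} : λ_I ≥ 0 for all I, Σ_I λ_I ≤ p − N, and Σ_{I=1}^{N−1} I·λ_I ≡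 −ℓ(p+q) − N(N−1)/2 (mod N)}. -/
/-- The extension of `ν` to `ℕ` satisfying `E (j + (n + 1)) = E j + p`. -/
def quasiPeriodicExtension {n : ℕ} (p : ℕ) (ν : Fin (n + 1) → ℤ) (j : ℕ) : ℤ :=
  ν ⟨j % (n + 1), Nat.mod_lt _ n.succ_pos⟩ + (p : ℤ) * ((j / (n + 1) : ℕ) : ℤ)

lemma quasiPeriodicExtension_add {n : ℕ} (p : ℕ) (ν : Fin (n + 1) → ℤ) (j : ℕ) :
    quasiPeriodicExtension p ν (j + (n + 1)) = quasiPeriodicExtension p ν j + p := by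
  simp only [quasiPeriodicExtension, Nat.add_mod_right, Nat.add_div_right j n.succ_pos]
  push_cast
  ring

lemma quasiPeriodicExtension_of_lt {n : ℕ} (p : ℕ) (ν : Fin (n + 1) → ℤ) {j : ℕ}
    (hj : j < n + 1) : quasiPeriodicExtension p ν j = ν ⟨j, hj⟩ := by
  simp [quasiPeriodicExtension, Nat.mod_eq_of_lt hj, Nat.div_eq_of_lt hj]

lemma quasiPeriodic_add_mul {N p : ℕ} {E : ℕ → ℤ} (hE : ∀ j, E (j + N) = E j + p) (j k : ℕ) :
    E (j + N * k) = E j + p * k := by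
  induction k with
  | zero => simp
  | succ k ih =>
    rw [Nat.mul_succ, ← add_assoc, hE, ih]
    push_cast
    ring

lemma quasiPeriodic_ext {n p : ℕ} {E F : ℕ → ℤ} (hE : ∀ j, E (j + (n + 1)) = E j + p)
    (hF : ∀ j, F (j + (n + 1)) = F j + p) (h : ∀ j < n + 1, E j = F j) (j : ℕ) : E j = F j := by
  rw [← Nat.mod_add_div j (n + 1), quasiPeriodic_add_mul hE, quasiPeriodic_add_mul hF,
    h _ (Nat.mod_lt _ n.succ_pos)]

lemma quasiPeriodic_strictMono {n p : ℕ} {E : ℕ → ℤ} (hE : ∀ j, E (j + (n + 1)) = E j + p)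
    (h : ∀ j < n, E j < E (j + 1)) (hlast : E n < E 0 + p) : StrictMono E := by
  refine strictMono_nat_of_lt_succ fun j => ?_
  have hmod := Nat.mod_lt j n.succ_pos
  have key : E (j % (n + 1)) < E (j % (n + 1) + 1) := by
    rcases Nat.lt_succ_iff_lt_or_eq.mp hmod with hj | hj
    · exact h _ hj
    · rw [hj]
      have h0 := hE 0
      rw [zero_add] at h0
      rwa [h0]
  have h1 := quasiPeriodic_add_mul hE (j % (n + 1)) (j / (n + 1))
  have h2 := quasiPeriodic_add_mul hE (j % (n + 1) + 1) (j / (n + 1))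
  rw [add_right_comm, Nat.mod_add_div] at h2
  rw [Nat.mod_add_div] at h1
  rw [h1, h2]
  linarith

lemma quasiPeriodic_sum_shift {N p : ℕ} {E : ℕ → ℤ} (hE : ∀ j, E (j + N) = E j + p) (ℓ : ℕ) :
    ∑ i ∈ Finset.range N, E (i + ℓ) = ∑ i ∈ Finset.range N, E i + ℓ * p := by
  induction ℓ with
  | zero => simp
  | succ ℓ ih =>
    have h := (Finset.sum_range_succ' (fun i => E (i + ℓ)) N).symm.trans
      (Finset.sum_range_succ (fun i => E (i + ℓ)) N)
    rw [add_comm N ℓ, hE, zero_add] at h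
    have h' : ∑ i ∈ Finset.range N, E (i + (ℓ + 1)) = ∑ i ∈ Finset.range N, E (i + 1 + ℓ) :=
      Finset.sum_congr rfl fun i _ => by rw [add_right_comm, add_assoc]
    rw [h']
    push_cast
    linarith

lemma sum_quasiPeriodicExtension_shift {n : ℕ} (p : ℕ) (ν : Fin (n + 1) → ℤ) (ℓ : ℕ) :
    ∑ i ∈ Finset.range (n + 1), quasiPeriodicExtension p ν (i + ℓ) = ∑ i, ν i + ℓ * p := by
  rw [quasiPeriodic_sum_shift (quasiPeriodicExtension_add p ν), Finset.sum_range]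
  congr 1
  exact Finset.sum_congr rfl fun i _ => quasiPeriodicExtension_of_lt p ν i.isLt

lemma strictMono_quasiPeriodicExtension {n p : ℕ} {ν : Fin (n + 1) → ℤ} (hν : StrictMono ν)
    (hlast : ν (Fin.last n) < ν 0 + p) : StrictMono (quasiPeriodicExtension p ν) := by
  refine quasiPeriodic_strictMono (quasiPeriodicExtension_add p ν) (fun j hj => ?_) ?_
  · rw [quasiPeriodicExtension_of_lt p ν (by omega : j < n + 1),
      quasiPeriodicExtension_of_lt p ν (by omega : j + 1 < n + 1)]
    exact hν (Fin.mk_lt_mk.mpr j.lt_succ_self)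
  · rwa [quasiPeriodicExtension_of_lt p ν n.lt_succ_self,
      quasiPeriodicExtension_of_lt p ν n.succ_pos]

lemma sum_range_succ_cast_eq (n : ℕ) :
    (((n + 1) * n / 2 : ℕ) : ℤ) = ∑ i ∈ Finset.range n, ((i + 1 : ℕ) : ℤ) := by
  have h := Finset.sum_range_id (n + 1)
  rw [Finset.sum_range_succ', Nat.add_sub_cancel, add_zero] at h
  rw [← h]
  push_cast
  rfl

lemma sum_range_succ_mul_sub (K : ℕ → ℤ) (n : ℕ) :
    ∑ i ∈ Finset.range n, ((i + 1 : ℕ) : ℤ) * (K (i + 1) - K i - 1) =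
      ((n + 1 : ℕ) : ℤ) * K n - ∑ i ∈ Finset.range (n + 1), K i
        - (((n + 1) * n / 2 : ℕ) : ℤ) := by
  rw [sum_range_succ_cast_eq]
  induction n with
  | zero => simp
  | succ n ih =>
    rw [Finset.sum_range_succ, ih, Finset.sum_range_succ _ (n + 1),
      Finset.sum_range_succ (fun i => ((i + 1 : ℕ) : ℤ)) n]
    push_cast
    ring

lemma sum_range_sub_sub_one (K : ℕ → ℤ) (n : ℕ) :
    ∑ i ∈ Finset.range n, (K (i + 1) - K i - 1) = K n - K 0 - n := by
  rw [Finset.sum_sub_distrib, Finset.sum_range_sub]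
  simp

/-- An integer sequence on `0, …, n` is determined by its first differences and its sum. -/
lemma eq_of_sub_eq_of_sum_eq {n : ℕ} {K L : ℕ → ℤ}
    (h : ∀ i < n, K (i + 1) - K i = L (i + 1) - L i)
    (hsum : ∑ i ∈ Finset.range (n + 1), K i = ∑ i ∈ Finset.range (n + 1), L i) :
    ∀ i < n + 1, K i = L i := by
  have hconst : ∀ i < n + 1, K i - L i = K 0 - L 0 := by
    intro i
    induction i with
    | zero => simp
    | succ i ih =>
      intro hi
      have h1 := h i (by omega)
      have h2 := ih (by omega)
      linarith
  have hzero : ((n + 1 : ℕ) : ℤ) * (K 0 - L 0) = 0 := by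
    have h1 := Finset.sum_congr rfl fun i hi => hconst i (Finset.mem_range.mp hi)
    rw [Finset.sum_sub_distrib, hsum, sub_self, Finset.sum_const, Finset.card_range,
      nsmul_eq_mul] at h1
    exact h1.symm
  have h0 : K 0 - L 0 = 0 := (mul_eq_zero.mp hzero).resolve_left (by positivity)
  intro i hi
  have := hconst i hi
  linarith

/-- There is an integer sequence on `ℕ` with prescribed first differences and prescribed value
at `n`. -/
lemma exists_seq_of_sub {n : ℕ} (lam : Fin n → ℤ) (c : ℤ) :
    ∃ K : ℕ → ℤ, K n = c ∧ ∀ i : Fin n, K (i + 1) - K i - 1 = lam i := by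
  let S : ℕ → ℤ := fun i =>
    ∑ j ∈ Finset.range i, ((if h : j < n then lam ⟨j, h⟩ else 0) + 1)
  refine ⟨fun i => S i - S n + c, by ring, fun i => ?_⟩
  have h : S (i + 1) = S i + (lam i + 1) := by
    simp [S, Finset.sum_range_succ]
  simp only [h]
  ring

/-- The map to weights expressed through the quasi-periodic extension is a bijection. -/
lemma bijOn_quasiPeriodicExtension_sub (n p : ℕ) (q : ℤ) (ℓ : ℕ) (hℓ : ℓ ≤ n) :
    Set.BijOn
      (fun (ν : Fin (n + 1) → ℤ) (I : Fin n) =>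
        quasiPeriodicExtension p ν (I + 1 + ℓ) - quasiPeriodicExtension p ν (I + ℓ) - 1)
      {ν | StrictMono ν ∧ ν (Fin.last n) < ν 0 + (p : ℤ) ∧ ∑ I, ν I = (ℓ : ℤ) * q}
      {lam | (∀ I, 0 ≤ lam I) ∧ ∑ I, lam I ≤ (p : ℤ) - ((n + 1 : ℕ) : ℤ) ∧
        Int.ModEq ((n + 1 : ℕ) : ℤ) (∑ I : Fin n, (((I : ℕ) + 1 : ℕ) : ℤ) * lam I)
          (-((ℓ : ℤ) * ((p : ℤ) + q)) - (((n + 1) * n / 2 : ℕ) : ℤ))} := by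
  refine ⟨?_, ?_, ?_⟩
  · rintro ν ⟨hν, hlast, hsum⟩
    have hmono := strictMono_quasiPeriodicExtension hν hlast
    refine ⟨fun I => ?_, ?_, ?_⟩
    · have := hmono (by omega : (I : ℕ) + ℓ < I + 1 + ℓ)
      show 0 ≤ _ - _ - 1
      omega
    · rw [← Finset.sum_range (fun i => quasiPeriodicExtension p ν (i + 1 + ℓ)
        - quasiPeriodicExtension p ν (i + ℓ) - 1),
        sum_range_sub_sub_one (fun i => quasiPeriodicExtension p ν (i + ℓ))]
      have h1 := hmono (by omega : n + ℓ < 0 + ℓ + (n + 1))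
      rw [quasiPeriodicExtension_add] at h1
      push_cast
      linarith
    · rw [← Finset.sum_range (fun i => ((i + 1 : ℕ) : ℤ) *
        (quasiPeriodicExtension p ν (i + 1 + ℓ) - quasiPeriodicExtension p ν (i + ℓ) - 1)),
        sum_range_succ_mul_sub (fun i => quasiPeriodicExtension p ν (i + ℓ)),
        sum_quasiPeriodicExtension_shift, hsum]
      refine Int.ModEq.symm (Int.modEq_iff_dvd.mpr ⟨quasiPeriodicExtension p ν (n + ℓ), ?_⟩)
      ring
  · rintro ν ⟨-, -, hsum⟩ ν' ⟨-, -, hsum'⟩ heq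
    have hK := eq_of_sub_eq_of_sum_eq (n := n)
      (K := fun i => quasiPeriodicExtension p ν (i + ℓ))
      (L := fun i => quasiPeriodicExtension p ν' (i + ℓ))
      (fun i hi => by
        have := congrFun heq ⟨i, hi⟩
        simpa using this)
      (by simp only [sum_quasiPeriodicExtension_shift, hsum, hsum'])
    have hall := quasiPeriodic_ext (n := n) (p := p)
      (E := fun i => quasiPeriodicExtension p ν (i + ℓ))
      (F := fun i => quasiPeriodicExtension p ν' (i + ℓ))
      (fun j => by simp only [add_right_comm j, quasiPeriodicExtension_add])
      (fun j => by simp only [add_right_comm j, quasiPeriodicExtension_add]) hK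
    funext j
    have h := hall (j + (n + 1 - ℓ))
    have hj : (j : ℕ) + (n + 1 - ℓ) + ℓ = j + (n + 1) := by omega
    simp only [hj, quasiPeriodicExtension_add, quasiPeriodicExtension_of_lt p _ j.isLt] at h
    exact add_right_cancel h
  · rintro lam ⟨hnonneg, hle, hmod⟩
    obtain ⟨c, hc⟩ := Int.modEq_iff_dvd.mp hmod.symm
    obtain ⟨K, hKn, hK⟩ := exists_seq_of_sub lam c
    set E := quasiPeriodicExtension p (fun i : Fin (n + 1) => K i)
    have hE : ∀ j, E (j + (n + 1)) = E j + p := quasiPeriodicExtension_add p _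
    have hEK : ∀ j < n + 1, E j = K j := fun j hj => quasiPeriodicExtension_of_lt p _ hj
    have hlam : ∀ i : Fin n, E (i + 1) - E i - 1 = lam i := fun i => by
      rw [hEK _ (by omega), hEK _ (by omega), hK]
    have hmono : StrictMono E := by
      refine quasiPeriodic_strictMono hE (fun j hj => ?_) ?_
      · have h1 : E (j + 1) - E j - 1 = lam ⟨j, hj⟩ := hlam ⟨j, hj⟩
        have h2 := hnonneg ⟨j, hj⟩
        omega
      · have h := sum_range_sub_sub_one E n
        rw [Finset.sum_range, Finset.sum_congr rfl fun i _ => hlam i] at h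
        push_cast at hle
        linarith
    let ν : Fin (n + 1) → ℤ := fun j => E (j + (n + 1 - ℓ)) - p
    have hν : ∀ j, quasiPeriodicExtension p ν (j + ℓ) = E j := by
      have h := quasiPeriodic_ext (n := n) (p := p) (E := quasiPeriodicExtension p ν)
        (F := fun j => E (j + (n + 1 - ℓ)) - p) (quasiPeriodicExtension_add p ν)
        (fun j => by rw [add_right_comm, hE]; ring)
        (fun j hj => quasiPeriodicExtension_of_lt p ν hj)
      intro j
      rw [h, (by omega : j + ℓ + (n + 1 - ℓ) = j + (n + 1)), hE]
      ring
    refine ⟨ν, ⟨fun i j hij => ?_, ?_, ?_⟩, ?_⟩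
    · have : E (i + (n + 1 - ℓ)) < E (j + (n + 1 - ℓ)) :=
        hmono (Nat.add_lt_add_right hij _)
      exact sub_lt_sub_right this _
    · have : E (n + (n + 1 - ℓ)) < E (0 + (n + 1 - ℓ) + (n + 1)) := hmono (by omega)
      rw [hE] at this
      simp only [ν, Fin.val_last, Fin.val_zero]
      linarith
    · have h1 := sum_quasiPeriodicExtension_shift p ν ℓ
      have h2 := sum_range_succ_mul_sub E n
      rw [Finset.sum_range, Finset.sum_congr rfl fun (i : Fin n) _ => by rw [hlam i],
        hEK n n.lt_succ_self, hKn] at h2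
      simp only [hν] at h1
      linarith
    · funext I
      show quasiPeriodicExtension p ν (I + 1 + ℓ) - quasiPeriodicExtension p ν (I + ℓ) - 1 = lam I
      rw [hν, hν, hlam]

/-- Differences of consecutive values of the quasi-periodic extension only depend on the index
modulo the period. -/
lemma quasiPeriodicExtension_succ_sub {n : ℕ} (p : ℕ) (ν : Fin (n + 1) → ℤ) (m : ℕ) :
    quasiPeriodicExtension p ν (m + 1) - quasiPeriodicExtension p ν m =
      quasiPeriodicExtension p ν ((m + 1) % (n + 1)) -
        (if (m + 1) % (n + 1) = 0 then ν (Fin.last n) - p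
          else quasiPeriodicExtension p ν ((m + 1) % (n + 1) - 1)) := by
  have hE := quasiPeriodicExtension_add p ν
  have hdiv := Nat.mod_add_div (m + 1) (n + 1)
  have h1 := quasiPeriodic_add_mul hE ((m + 1) % (n + 1)) ((m + 1) / (n + 1))
  rw [hdiv] at h1
  split_ifs with h
  · have h2 := quasiPeriodic_add_mul hE n ((m + 1) / (n + 1))
    have hm : n + (n + 1) * ((m + 1) / (n + 1)) = m + (n + 1) := by omega
    rw [hm, hE, quasiPeriodicExtension_of_lt p ν n.lt_succ_self] at h2
    change _ = ν (Fin.last n) + _ at h2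
    linarith
  · have h2 := quasiPeriodic_add_mul hE ((m + 1) % (n + 1) - 1) ((m + 1) / (n + 1))
    have hm : (m + 1) % (n + 1) - 1 + (n + 1) * ((m + 1) / (n + 1)) = m := by omega
    rw [hm] at h2
    linarith


/-- The cyclically permuted map ν ↦ λ,
λ_I = ν_{σ(I)+1} − ν_{σ(I)} − 1 with σ(I) = (I + ℓ) mod N and ν₀ = ν_N − p
(here I : Fin (N−1) represents the index I+1 ∈ {1,…,N−1}, and indices
1,…,N of ν are represented by Fin N via j ↦ j−1), is a bijection from
{ν : ν₁ < ⋯ < ν_N < ν₁ + p, Σ ν_I = ℓq} onto the set of λ ∈ ℤ^{N−1} with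
λ_I ≥ 0, Σ λ_I ≤ p − N, and Σ I·λ_I ≡ −ℓ(p+q) − N(N−1)/2 (mod N). -/
theorem stmt_7 (N p : ℕ) (hN : 1 ≤ N) (hp : 1 ≤ p) (q : ℤ)
    (ℓ : ℕ) (hℓ : ℓ ≤ N - 1) :
    Set.BijOn
      (fun ν : Fin N → ℤ =>
        let νE : ℕ → ℤ := fun j =>
          if j = 0 then ν ⟨N - 1, by omega⟩ - (p : ℤ)
          else if h2 : j ≤ N then ν ⟨j - 1, by omega⟩ else 0
        fun I : Fin (N - 1) =>
          νE ((((I : ℕ) + 1 + ℓ) % N) + 1) - νE (((I : ℕ) + 1 + ℓ) % N) - 1)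
      {ν : Fin N → ℤ | StrictMono ν ∧
        ν ⟨N - 1, by omega⟩ < ν ⟨0, by omega⟩ + (p : ℤ) ∧
        (∑ I, ν I) = (ℓ : ℤ) * q}
      {lam : Fin (N - 1) → ℤ | (∀ I, 0 ≤ lam I) ∧
        (∑ I, lam I) ≤ (p : ℤ) - (N : ℤ) ∧
        Int.ModEq (N : ℤ) (∑ I : Fin (N - 1), (((I : ℕ) + 1 : ℕ) : ℤ) * lam I)
          (-((ℓ : ℤ) * ((p : ℤ) + q)) - ((N * (N - 1) / 2 : ℕ) : ℤ))} := by
  obtain ⟨n, rfl⟩ : ∃ n, N = n + 1 := ⟨N - 1, by omega⟩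
  refine (bijOn_quasiPeriodicExtension_sub n p q ℓ hℓ).congr fun ν _ => ?_
  funext I
  have hlt : ((I : ℕ) + 1 + ℓ) % (n + 1) < n + 1 := Nat.mod_lt _ n.succ_pos
  have h := quasiPeriodicExtension_succ_sub p ν (I + ℓ)
  rw [add_right_comm (I : ℕ) ℓ 1] at h
  simp only [h, Nat.add_eq_zero_iff, one_ne_zero, and_false, if_false, Nat.add_sub_cancel]
  rw [dif_pos (by omega : ((I : ℕ) + 1 + ℓ) % (n + 1) + 1 ≤ n + 1),
    quasiPeriodicExtension_of_lt p ν hlt]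
  congr 2
  split_ifs with h0 h1
  · rfl
  · exact quasiPeriodicExtension_of_lt p ν (by omega)
  · omega
end

section
/- Fix an integer N ≥ 2, an integer n ≥ 1, and pairs of integers (p_k, q_k) for k = 1,…,n with p_k ≥ 1 and gcd(N, q_k) = 1; for each k fix an integer t_k with q_k · t_k ≡ 1 (mod N). Let ℛ be the set of pairs (ℓ, ν) where ℓ ∈ {0,…,N−1} and ν = (ν_k^{(I)}) ∈ ℤ^{n×N} satisfies, for every k: ν_k^{(1)} < ν_k^{(2)} < ⋯ < ν_k^{(N)} < ν_k^{(1)} + p_k and Σ_{I=1}^{N} ν_k^{(I)} = ℓ q_k. Let 𝒮 be the set of λ = (λ_k^{(I)}) ∈ ℤ^{n×(N−1)} such that, for every k: λ_k^{(I)} ≥ 0 for all I, Σ_{I=1}^{N−1} λ_k^{(I)} ≤ p_k − N, and the residue t_k · Σ_{I=1}^{N−1} I·λ_k^{(I)} mod N is the same for all k = 1,…,n. Then the map (ℓ, ν) ↦ λ with λ_k^{(I)} = ν_k^{(I+1)} − ν_k^{(I)} − 1 is a bijection from ℛ onto 𝒮. -/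
/-- The pairing of the vector `(1, …, m)` with the shifted consecutive differences of `g`. -/
theorem sum_succ_mul_diff (m : ℕ) (g : Fin (m + 1) → ℤ) :
    2 * ∑ i : Fin m, (((i : ℕ) + 1 : ℕ) : ℤ) * (g i.succ - g i.castSucc - 1) =
      2 * (((m + 1 : ℕ) : ℤ) * g (Fin.last m) - ∑ i, g i) - m * (m + 1) := by
  induction m with
  | zero => simp
  | succ m ih =>
    have h := ih (fun i => g i.castSucc)
    rw [Fin.sum_univ_castSucc, Fin.sum_univ_castSucc (f := g)]
    simp only [Fin.val_castSucc, Fin.val_last, Fin.succ_castSucc, Fin.succ_last] at h ⊢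
    push_cast at h ⊢
    linarith

/-- Telescoping of the shifted consecutive differences of `g`. -/
theorem sum_diff_sub_one (m : ℕ) (g : Fin (m + 1) → ℤ) :
    ∑ i : Fin m, (g i.succ - g i.castSucc - 1) = g (Fin.last m) - g 0 - m := by
  induction m with
  | zero => simp
  | succ m ih =>
    have h := ih (fun i => g i.castSucc)
    rw [Fin.sum_univ_castSucc]
    simp only [Fin.succ_castSucc, Fin.succ_last, Fin.castSucc_zero] at h ⊢
    push_cast at h ⊢
    linarith

theorem exists_diff_sub_one_eq {m : ℕ} (w : Fin m → ℤ) :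
    ∃ g : Fin (m + 1) → ℤ, ∀ i : Fin m, g i.succ - g i.castSucc - 1 = w i := by
  refine ⟨fun i => Fin.induction (motive := fun _ => ℤ) 0 (fun j x => x + w j + 1) i, fun i => ?_⟩
  simp only [Fin.induction_succ]
  ring

theorem eq_add_const_of_diff_eq {m : ℕ} {g g' : Fin (m + 1) → ℤ}
    (h : ∀ i : Fin m, g i.succ - g i.castSucc - 1 = g' i.succ - g' i.castSucc - 1)
    (i : Fin (m + 1)) : g i = g' i + (g 0 - g' 0) := by
  induction i using Fin.induction with
  | zero => ring
  | succ i ih => linarith [h i]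

/-- Units modulo `m + 1` fix the residue of the triangular number `m (m + 1) / 2`. -/
theorem dvd_sub_one_mul_triangular {m : ℕ} {q T : ℤ} (hq : Int.gcd ((m + 1 : ℕ) : ℤ) q = 1)
    (hT : 2 * T = m * (m + 1)) : ((m + 1 : ℕ) : ℤ) ∣ (q - 1) * T := by
  rcases Nat.even_or_odd' m with ⟨a, rfl | rfl⟩
  · refine ⟨(q - 1) * a, ?_⟩
    have : T = a * (2 * a + 1) := by push_cast at hT; linarith
    rw [this]; push_cast; ring
  · have hodd : ¬ (2 : ℤ) ∣ q := fun h => by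
      have h2 := Int.dvd_coe_gcd (a := ((2 * a + 1 + 1 : ℕ) : ℤ)) ⟨(a : ℤ) + 1, by push_cast; ring⟩ h
      rw [hq] at h2
      norm_num at h2
    obtain ⟨b, hb⟩ : (2 : ℤ) ∣ q - 1 := by omega
    refine ⟨b * (2 * a + 1), ?_⟩
    rw [hb]
    push_cast at hT ⊢
    linear_combination b * hT

/-- The weight `Σ I·λ^{(I)}` modulo `m + 1`, where `λ` are the shifted differences of `g`. -/
theorem sum_succ_mul_diff_eq {m : ℕ} {T : ℤ} (hT : 2 * T = m * (m + 1)) (g : Fin (m + 1) → ℤ) :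
    ∑ i : Fin m, (((i : ℕ) + 1 : ℕ) : ℤ) * (g i.succ - g i.castSucc - 1) =
      ((m + 1 : ℕ) : ℤ) * g (Fin.last m) - ∑ i, g i - T := by
  linarith [sum_succ_mul_diff m g]

/-- For Seifert data (p_k,q_k), k = 1,…,n, with gcd(N,q_k) = 1
and inverses t_k of q_k mod N, the map (ℓ, ν) ↦ λ with
λ_k^{(I)} = ν_k^{(I+1)} − ν_k^{(I)} − 1 is a bijection from the set ℛ of
anyonic flat connection data onto the set 𝒮 of tuples of alcove weights whose
residues t_k·Σ I·λ_k^{(I)} mod N all coincide.  (Here I : Fin (N−1)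
represents the index I+1 ∈ {1,…,N−1}.) -/
theorem stmt_8 (N n : ℕ) (hN : 2 ≤ N) (hn : 1 ≤ n)
    (p q t : Fin n → ℤ) (hp : ∀ k, 1 ≤ p k)
    (hco : ∀ k, Int.gcd (N : ℤ) (q k) = 1)
    (ht : ∀ k, Int.ModEq (N : ℤ) (q k * t k) 1) :
    Set.BijOn
      (fun x : ℕ × (Fin n → Fin N → ℤ) => fun k : Fin n => fun I : Fin (N - 1) =>
        x.2 k ⟨(I : ℕ) + 1, by have := I.isLt; omega⟩ -
          x.2 k ⟨(I : ℕ), by have := I.isLt; omega⟩ - 1)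
      {x : ℕ × (Fin n → Fin N → ℤ) | x.1 ≤ N - 1 ∧ ∀ k : Fin n,
        StrictMono (x.2 k) ∧
        x.2 k ⟨N - 1, by omega⟩ < x.2 k ⟨0, by omega⟩ + p k ∧
        (∑ I, x.2 k I) = (x.1 : ℤ) * q k}
      {lam : Fin n → Fin (N - 1) → ℤ |
        (∀ k : Fin n, (∀ I, 0 ≤ lam k I) ∧ (∑ I, lam k I) ≤ p k - (N : ℤ)) ∧
        ∀ k k' : Fin n,
          Int.ModEq (N : ℤ)
            (t k * ∑ I : Fin (N - 1), (((I : ℕ) + 1 : ℕ) : ℤ) * lam k I)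
            (t k' * ∑ I : Fin (N - 1), (((I : ℕ) + 1 : ℕ) : ℤ) * lam k' I)} := by
  obtain ⟨m, rfl⟩ : ∃ m, N = m + 1 := ⟨N - 1, by omega⟩
  obtain ⟨T, hT⟩ : ∃ T : ℤ, 2 * T = m * (m + 1) := by
    obtain ⟨T, hT⟩ := Int.even_mul_succ_self (m : ℤ)
    exact ⟨T, by linarith⟩
  have hqT k := dvd_sub_one_mul_triangular (hco k) hT
  refine ⟨?_, ?_, ?_⟩
  · rintro ⟨l, v⟩ ⟨-, hv⟩
    have hv : ∀ k, StrictMono (v k) ∧ v k (Fin.last m) < v k 0 + p k ∧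
      ∑ I, v k I = (l : ℤ) * q k := hv
    change (∀ k, (∀ I : Fin m, 0 ≤ v k I.succ - v k I.castSucc - 1) ∧
        ∑ I : Fin m, (v k I.succ - v k I.castSucc - 1) ≤ p k - ((m + 1 : ℕ) : ℤ)) ∧
      ∀ k k', Int.ModEq ((m + 1 : ℕ) : ℤ)
        (t k * ∑ I : Fin m, (((I : ℕ) + 1 : ℕ) : ℤ) * (v k I.succ - v k I.castSucc - 1))
        (t k' * ∑ I : Fin m, (((I : ℕ) + 1 : ℕ) : ℤ) * (v k' I.succ - v k' I.castSucc - 1))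
    refine ⟨fun k => ⟨fun I => ?_, ?_⟩, ?_⟩
    · have := (hv k).1 (Fin.castSucc_lt_succ (i := I))
      omega
    · rw [sum_diff_sub_one]
      have := (hv k).2.1
      push_cast
      linarith
    · suffices h : ∀ k, Int.ModEq ((m + 1 : ℕ) : ℤ) (t k * ∑ I : Fin m,
          (((I : ℕ) + 1 : ℕ) : ℤ) * (v k I.succ - v k I.castSucc - 1)) (-l - T) from
        fun k k' => (h k).trans (h k').symm
      intro k
      rw [sum_succ_mul_diff_eq hT, (hv k).2.2]
      obtain ⟨a, ha⟩ := hqT k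
      obtain ⟨b, hb⟩ := (ht k).dvd
      refine Int.modEq_iff_dvd.2 ⟨-t k * v k (Fin.last m) - b * l - b * T + t k * -a, ?_⟩
      linear_combination (-(l : ℤ) - T) * hb - t k * ha
  · rintro ⟨l, v⟩ ⟨hl, hv⟩ ⟨l', v'⟩ ⟨hl', hv'⟩ heq
    have hl : l ≤ m := hl
    have hl' : l' ≤ m := hl'
    have hshift : ∀ k i, v k i = v' k i + (v k 0 - v' k 0) := fun k =>
      eq_add_const_of_diff_eq fun i => congrFun (congrFun heq k) i
    have hsum : ∀ k, (l : ℤ) * q k = l' * q k + ((m + 1 : ℕ) : ℤ) * (v k 0 - v' k 0) := by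
      intro k
      have h1 : ∑ I, v k I = (l : ℤ) * q k := (hv k).2.2
      have h2 : ∑ I, v' k I = (l' : ℤ) * q k := (hv' k).2.2
      rw [← h1, ← h2, Finset.sum_congr rfl fun i _ => hshift k i, Finset.sum_add_distrib]
      simp [mul_sub]
    have hll : l = l' := by
      let k : Fin n := ⟨0, hn⟩
      have hdvd : ((m + 1 : ℕ) : ℤ) ∣ q k * ((l : ℤ) - l') :=
        ⟨v k 0 - v' k 0, by linear_combination hsum k⟩
      have h0 := Int.eq_zero_of_abs_lt_dvd (Int.dvd_of_dvd_mul_right_of_gcd_one hdvd (hco k))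
        (by rw [abs_lt]; omega)
      omega
    subst hll
    refine Prod.ext rfl (funext fun k => funext fun i => ?_)
    have h0 : ((m + 1 : ℕ) : ℤ) * (v k 0 - v' k 0) = 0 := by linarith [hsum k]
    rcases mul_eq_zero.1 h0 with h | h
    · omega
    · have := hshift k i
      rwa [h, add_zero] at this
  · rintro w ⟨hw, hmod⟩
    have hw : ∀ k, (∀ I : Fin m, 0 ≤ w k I) ∧ ∑ I : Fin m, w k I ≤ p k - ((m + 1 : ℕ) : ℤ) := hw
    choose g hg using fun k => exists_diff_sub_one_eq (m := m) (w k)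
    let φ : Fin n → ℤ := fun k => ∑ I : Fin m, (((I : ℕ) + 1 : ℕ) : ℤ) * w k I
    have hmod : ∀ k k', Int.ModEq ((m + 1 : ℕ) : ℤ) (t k * φ k) (t k' * φ k') := hmod
    have hφ : ∀ k, φ k = ((m + 1 : ℕ) : ℤ) * g k (Fin.last m) - ∑ i, g k i - T := fun k => by
      rw [← sum_succ_mul_diff_eq hT]
      exact Finset.sum_congr rfl fun i _ => by rw [hg]
    obtain ⟨l, hlm, hl⟩ : ∃ l : ℕ, l ≤ m ∧
        ∀ k, Int.ModEq ((m + 1 : ℕ) : ℤ) l (-(t k * φ k) - T) := by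
      let k : Fin n := ⟨0, hn⟩
      have hpos : (0 : ℤ) < ((m + 1 : ℕ) : ℤ) := by positivity
      have h0 := Int.emod_nonneg (-(t k * φ k) - T) hpos.ne'
      have h1 := Int.emod_lt_of_pos (-(t k * φ k) - T) hpos
      refine ⟨((-(t k * φ k) - T) % ((m + 1 : ℕ) : ℤ)).toNat, by omega, fun k' => ?_⟩
      rw [Int.toNat_of_nonneg h0]
      exact (Int.mod_modEq _ _).trans ((hmod k k').neg.sub_right T)
    have hc : ∀ k, ∃ c : ℤ, (l : ℤ) * q k - ∑ i, g k i = ((m + 1 : ℕ) : ℤ) * c := by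
      intro k
      obtain ⟨a, ha⟩ := hqT k
      obtain ⟨b, hb⟩ := (ht k).dvd
      obtain ⟨d, hd⟩ := (hl k).dvd
      refine ⟨b * φ k - a - d * q k - g k (Fin.last m), ?_⟩
      linear_combination φ k * hb - ha - q k * hd - hφ k
    choose c hc using hc
    have hdiff : ∀ k (I : Fin m),
        (g k I.succ + c k) - (g k I.castSucc + c k) - 1 = w k I := fun k I => by
      linarith [hg k I]
    refine ⟨(l, fun k i => g k i + c k), ⟨hlm, fun k => ⟨?_, ?_, ?_⟩⟩,
      funext fun k => funext fun I => hdiff k I⟩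
    · refine Fin.strictMono_iff_lt_succ.2 fun I => ?_
      have h1 := hdiff k I
      have h2 := (hw k).1 I
      change g k I.castSucc + c k < g k I.succ + c k
      linarith
    · change g k (Fin.last m) + c k < g k 0 + c k + p k
      have h1 := sum_diff_sub_one m (g k)
      rw [Finset.sum_congr rfl fun i _ => hg k i] at h1
      have h2 := (hw k).2
      push_cast at h2
      linarith
    · change ∑ i, (g k i + c k) = (l : ℤ) * q k
      rw [Finset.sum_add_distrib]
      simp only [Finset.sum_const, Finset.card_univ, Fintype.card_fin, nsmul_eq_mul]
      linarith [hc k]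
end

section
/- Fix integers N ≥ 2, p ≥ 1, and q with gcd(p,q) = 1 and gcd(N,q) = 1, and let x, r, s be integers with q·x ≡ shadows 1 (mod 2pN) and p·s − q·r = 1. Define B_{IJ} = N·min(I,J) − I·J for 1 ≤ I,J ≤ N−1. For ℓ ∈ {0,…,N−1} and ν = (ν₁,…,ν_N) ∈ ℤ^N with ν₁ < ⋯ < ν_N < ν₁ + p and Σ_I ν_I = ℓq, set λ_I = ν_{I+1} − ν_I − 1, a_I = (ν_I − ℓq/N)/p ∈ ℚ, and F(ℓ,ν) = (x/(2pN))·Σ_{I,J=1}^{N−1} B_{IJ}·λ_I·(λ_J + 2) + (p·r/2)·Σ_{I=1}^{N} a_I² − (q·s/2)·(N−1)·ℓ²/N ∈ ℚ. Then for any two admissible data (ℓ,ν) and (ℓ′,ν′), the difference F(ℓ,ν) − F(ℓ′,ν′) is an integer. (Here 'q·x ≡ 1 (mod 2pN)'.) -/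
/-- The quantity F(ℓ,ν) of STATEMENT 9:
F = (x/(2pN))·Σ_{I,J} B_{IJ}·λ_I·(λ_J+2) + (p·r/2)·Σ_I a_I² − (q·s/2)·(N−1)ℓ²/N,
where B_{IJ} = N·min(I,J) − I·J, λ_I = ν_{I+1} − ν_I − 1 and
a_I = (ν_I − ℓq/N)/p.  (Here i : Fin (N−1) represents the index I = i+1.) -/
noncomputable def seifertTwistCS (N p : ℕ) (q x r s : ℤ) (ℓ : ℕ) (ν : Fin N → ℤ) : ℚ :=
  (x : ℚ) / (2 * (p : ℚ) * (N : ℚ)) *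
    (∑ i : Fin (N - 1), ∑ j : Fin (N - 1),
      ((N : ℚ) * ((min ((i : ℕ) + 1) ((j : ℕ) + 1) : ℕ) : ℚ) -
          (((i : ℕ) + 1 : ℕ) : ℚ) * (((j : ℕ) + 1 : ℕ) : ℚ)) *
        ((ν ⟨(i : ℕ) + 1, by have := i.isLt; omega⟩ -
            ν ⟨(i : ℕ), by have := i.isLt; omega⟩ - 1 : ℤ) : ℚ) *
        (((ν ⟨(j : ℕ) + 1, by have := j.isLt; omega⟩ -
            ν ⟨(j : ℕ), by have := j.isLt; omega⟩ - 1 : ℤ) : ℚ) + 2)) +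
  ((p : ℚ) * (r : ℚ) / 2) *
    (∑ I : Fin N, (((ν I : ℚ) - (ℓ : ℚ) * (q : ℚ) / (N : ℚ)) / (p : ℚ)) ^ 2) -
  ((q : ℚ) * (s : ℚ) / 2) * ((N : ℚ) - 1) * (ℓ : ℚ) ^ 2 / (N : ℚ)

open Finset in
/-- Summation by parts for the weights `i + 1`. -/
theorem sum_succ_mul_sub (g : ℕ → ℚ) (n : ℕ) :
    ∑ i ∈ range n, ((i : ℚ) + 1) * (g (i + 1) - g i) =
      (n + 1) * g n - ∑ i ∈ range (n + 1), g i := by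
  induction n with
  | zero => simp
  | succ n ih =>
    rw [sum_range_succ, ih, sum_range_succ _ (n + 1)]
    push_cast
    ring

open Finset in
/-- The quadratic form with matrix `min (i + 1) (j + 1)`, evaluated on the increments of `g`. -/
theorem sum_min_mul_sub_mul_sub (g : ℕ → ℚ) (n : ℕ) :
    ∑ i ∈ range n, ∑ j ∈ range n,
        ((min (i + 1) (j + 1) : ℕ) : ℚ) * (g (i + 1) - g i) * (g (j + 1) - g j) =
      (n + 1) * g n ^ 2 - 2 * g n * ∑ i ∈ range (n + 1), g i +
        ∑ i ∈ range (n + 1), g i ^ 2 := by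
  induction n with
  | zero => simp; ring
  | succ n ih =>
    have row : ∑ j ∈ range n,
        ((min (n + 1) (j + 1) : ℕ) : ℚ) * (g (n + 1) - g n) * (g (j + 1) - g j) =
        (g (n + 1) - g n) * ∑ j ∈ range n, ((j : ℚ) + 1) * (g (j + 1) - g j) := by
      rw [mul_sum]
      refine sum_congr rfl fun j hj => ?_
      rw [min_eq_right (by have := mem_range.1 hj; omega)]
      push_cast
      ring
    have col : ∑ i ∈ range n,
        ((min (i + 1) (n + 1) : ℕ) : ℚ) * (g (i + 1) - g i) * (g (n + 1) - g n) =
        (g (n + 1) - g n) * ∑ j ∈ range n, ((j : ℚ) + 1) * (g (j + 1) - g j) := by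
      rw [← row]
      refine sum_congr rfl fun j _ => ?_
      rw [min_comm]
      ring
    simp only [sum_range_succ _ n, sum_add_distrib] at ih ⊢
    rw [sum_range_succ, sum_range_succ _ (n + 1)]
    simp only [sum_range_succ _ n]
    rw [ih, row, col, sum_succ_mul_sub, sum_range_succ, min_self]
    push_cast
    ring

open Finset in
/-- The quadratic form with matrix `(n + 1) min(I, J) - I J` on shifted increments, in terms of the
values of `g`. -/
theorem sum_weight_form (g : ℕ → ℚ) (n : ℕ) :
    ∑ i ∈ range n, ∑ j ∈ range n,
        (((n + 1 : ℕ) : ℚ) * ((min (i + 1) (j + 1) : ℕ) : ℚ) -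
            ((i + 1 : ℕ) : ℚ) * ((j + 1 : ℕ) : ℚ)) *
          (g (i + 1) - g i - 1) * ((g (j + 1) - g j - 1) + 2) =
      (n + 1) * ∑ i ∈ range (n + 1), g i ^ 2 - (∑ i ∈ range (n + 1), g i) ^ 2 -
        ∑ i ∈ range n, ∑ j ∈ range n,
          (((n + 1 : ℕ) : ℚ) * ((min (i + 1) (j + 1) : ℕ) : ℚ) -
            ((i + 1 : ℕ) : ℚ) * ((j + 1 : ℕ) : ℚ)) := by
  set b : ℕ → ℕ → ℚ := fun i j => ((n + 1 : ℕ) : ℚ) * ((min (i + 1) (j + 1) : ℕ) : ℚ) -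
            ((i + 1 : ℕ) : ℚ) * ((j + 1 : ℕ) : ℚ) with hb
  have hsymm : ∀ i j, b i j = b j i := fun i j => by simp only [hb, min_comm (i + 1)]; ring
  have cross : ∑ i ∈ range n, ∑ j ∈ range n, b i j * (g (i + 1) - g i) =
      ∑ i ∈ range n, ∑ j ∈ range n, b i j * (g (j + 1) - g j) := by
    rw [sum_comm]
    exact sum_congr rfl fun i _ => sum_congr rfl fun j _ => by rw [hsymm]
  have main : ∑ i ∈ range n, ∑ j ∈ range n, b i j * (g (i + 1) - g i) * (g (j + 1) - g j) =
      (n + 1) * ∑ i ∈ range (n + 1), g i ^ 2 - (∑ i ∈ range (n + 1), g i) ^ 2 := by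
    have hsplit : ∑ i ∈ range n, ∑ j ∈ range n,
          b i j * (g (i + 1) - g i) * (g (j + 1) - g j) =
        (n + 1) * ∑ i ∈ range n, ∑ j ∈ range n,
          ((min (i + 1) (j + 1) : ℕ) : ℚ) * (g (i + 1) - g i) * (g (j + 1) - g j) -
        (∑ i ∈ range n, ((i : ℚ) + 1) * (g (i + 1) - g i)) *
          ∑ j ∈ range n, ((j : ℚ) + 1) * (g (j + 1) - g j) := by
      rw [sum_mul_sum]
      simp only [mul_sum, ← sum_sub_distrib]
      refine sum_congr rfl fun i _ => sum_congr rfl fun j _ => ?_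
      simp only [hb]
      push_cast
      ring
    rw [hsplit, sum_min_mul_sub_mul_sub, sum_succ_mul_sub]
    ring
  calc _ = ∑ i ∈ range n, ∑ j ∈ range n, (b i j * (g (i + 1) - g i) * (g (j + 1) - g j) +
          b i j * (g (i + 1) - g i) - b i j * (g (j + 1) - g j) - b i j) :=
        sum_congr rfl fun i _ => sum_congr rfl fun j _ => by ring
    _ = _ := by
      simp only [sum_sub_distrib, sum_add_distrib]
      rw [main, cross, add_sub_cancel_right]
      simp only [hb, sum_sub_distrib]

/-- Closed form of `seifertTwistCS` in terms of `∑ ν_I ^ 2` and `∑ ν_I`. -/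
theorem seifertTwistCS_succ (n p : ℕ) (hp : 1 ≤ p) (q x r s : ℤ) (ℓ : ℕ) (ν : Fin (n + 1) → ℤ)
    (hsum : (∑ I, ν I) = (ℓ : ℤ) * q) :
    seifertTwistCS (n + 1) p q x r s ℓ ν =
      (x + r) / (2 * p) * ((∑ I, ν I ^ 2 : ℤ) : ℚ) -
        (x + r) * (ℓ * q) ^ 2 / (2 * p * (n + 1)) - q * s * n * ℓ ^ 2 / (2 * (n + 1)) -
        x / (2 * p * (n + 1)) * ∑ i ∈ Finset.range n, ∑ j ∈ Finset.range n,
          (((n + 1 : ℕ) : ℚ) * ((min (i + 1) (j + 1) : ℕ) : ℚ) -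
            ((i + 1 : ℕ) : ℚ) * ((j + 1 : ℕ) : ℚ)) := by
  obtain ⟨g, hg⟩ : ∃ g : ℕ → ℚ, ∀ I : Fin (n + 1), (ν I : ℚ) = g I :=
    ⟨fun k => if h : k < n + 1 then (ν ⟨k, h⟩ : ℚ) else 0, fun I => by simp [I.isLt]⟩
  have hsum₁ : ∑ i ∈ Finset.range (n + 1), g i = ℓ * q := by
    rw [Finset.sum_range, ← Finset.sum_congr rfl fun I _ => hg I]
    exact_mod_cast hsum
  have hsum₂ : ∑ i ∈ Finset.range (n + 1), g i ^ 2 = ((∑ I, ν I ^ 2 : ℤ) : ℚ) := by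
    rw [Finset.sum_range]
    push_cast
    simp only [hg]
  have hform := sum_weight_form g n
  rw [Finset.sum_range] at hform
  simp only [Finset.sum_range (n := n)] at hform
  have hp0 : (p : ℚ) ≠ 0 := by positivity
  have hn0 : (n : ℚ) + 1 ≠ 0 := by positivity
  have hsq : ∑ I : Fin (n + 1), (((ν I : ℚ) - (ℓ : ℚ) * (q : ℚ) / ((n + 1 : ℕ) : ℚ)) / p) ^ 2 =
      (((∑ I, ν I ^ 2 : ℤ) : ℚ) - (ℓ * q) ^ 2 / (n + 1)) / p ^ 2 := by
    have h : ∀ c : ℚ, ∑ I : Fin (n + 1), (((ν I : ℚ) - c) / p) ^ 2 =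
        (((∑ I, ν I ^ 2 : ℤ) : ℚ) - 2 * c * (ℓ * q) + (n + 1) * c ^ 2) / p ^ 2 := by
      intro c
      have h₁ : ∑ I : Fin (n + 1), (ν I : ℚ) = ℓ * q := by exact_mod_cast hsum
      rw [← h₁]
      simp only [div_pow, ← Finset.sum_div, sub_sq, Finset.sum_add_distrib,
        Finset.sum_sub_distrib, Finset.mul_sum, Finset.sum_const, Finset.card_univ,
        Fintype.card_fin, nsmul_eq_mul]
      push_cast
      congr 3
      exact Finset.sum_congr rfl fun I _ => by ring
    rw [h]
    push_cast
    field_simp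
    ring
  unfold seifertTwistCS
  rw [hsq]
  simp only [Int.cast_sub, hg, Int.cast_one]
  simp only [Finset.sum_range (n := n)]
  erw [hform]
  rw [hsum₁, hsum₂]
  push_cast
  field_simp
  ring

/-- Under the congruence conditions, `seifertTwistCS` is a constant up to an integer. -/
theorem exists_seifertTwistCS_succ_eq (n p : ℕ) (hp : 1 ≤ p) (q x r s : ℤ)
    (hpq : Int.gcd (p : ℤ) q = 1)
    (hx : Int.ModEq (2 * (p : ℤ) * ((n + 1 : ℕ) : ℤ)) (q * x) 1)
    (hrs : (p : ℤ) * s - q * r = 1) (ℓ : ℕ) (ν : Fin (n + 1) → ℤ)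
    (hsum : (∑ I, ν I) = (ℓ : ℤ) * q) :
    ∃ m : ℤ, seifertTwistCS (n + 1) p q x r s ℓ ν = m -
        x / (2 * p * (n + 1)) * ∑ i ∈ Finset.range n, ∑ j ∈ Finset.range n,
          (((n + 1 : ℕ) : ℚ) * ((min (i + 1) (j + 1) : ℕ) : ℚ) -
            ((i + 1 : ℕ) : ℚ) * ((j + 1 : ℕ) : ℚ)) := by
  obtain ⟨k, hk⟩ := hx.symm.dvd
  push_cast at hk
  have hmul : q * (x + r) = p * (s + 2 * (n + 1) * k) := by linear_combination hk - hrs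
  obtain ⟨t, ht⟩ : (p : ℤ) ∣ x + r :=
    (Int.isCoprime_iff_gcd_eq_one.2 hpq).dvd_of_dvd_mul_left ⟨_, hmul⟩
  have hp0 : (p : ℤ) ≠ 0 := by positivity
  have hqt : q * t = s + 2 * (n + 1) * k := by
    apply mul_left_cancel₀ hp0
    rw [← hmul, ht]
    ring
  obtain ⟨e, he⟩ : (2 : ℤ) ∣ (∑ I, ν I ^ 2) - (ℓ * q) ^ 2 := by
    have hpar : ∀ a : ℤ, (2 : ℤ) ∣ a ^ 2 - a := fun a => by
      rw [sq, ← mul_sub_one]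
      exact (Int.even_mul_pred_self a).two_dvd
    have h := dvd_sub (Finset.dvd_sum fun I (_ : I ∈ Finset.univ) => hpar (ν I))
      (hpar (ℓ * q))
    rw [Finset.sum_sub_distrib, hsum] at h
    simpa only [sub_sub_sub_cancel_right] using h
  refine ⟨t * e + q * k * n * ℓ ^ 2, ?_⟩
  rw [seifertTwistCS_succ n p hp q x r s ℓ ν hsum]
  congr 1
  have hS : ((∑ I, ν I ^ 2 : ℤ) : ℚ) = (ℓ * q) ^ 2 + 2 * e := by
    rw [eq_add_of_sub_eq' he]
    push_cast
    ring
  have hxr : (x : ℚ) + r = p * t := by exact_mod_cast ht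
  have hs : (s : ℚ) = q * t - 2 * (n + 1) * k := by
    rw [eq_sub_iff_add_eq]
    exact_mod_cast hqt.symm
  have hp0' : (p : ℚ) ≠ 0 := by exact_mod_cast hp0
  have hn0 : (n : ℚ) + 1 ≠ 0 := by positivity
  rw [hS, hxr, hs]
  push_cast
  field_simp
  ring

/-- With gcd(p,q) = 1, gcd(N,q) = 1, q·x ≡ 1 (mod 2pN) and
p·s − q·r = 1, for any two admissible data (ℓ,ν) and (ℓ′,ν′)
(ℓ ∈ {0,…,N−1}, ν₁ < ⋯ < ν_N < ν₁ + p, Σ ν_I = ℓq) the difference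
F(ℓ,ν) − F(ℓ′,ν′) is an integer. -/
theorem stmt_9 (N p : ℕ) (hN : 2 ≤ N) (hp : 1 ≤ p) (q x r s : ℤ)
    (hpq : Int.gcd (p : ℤ) q = 1) (hNq : Int.gcd (N : ℤ) q = 1)
    (hx : Int.ModEq (2 * (p : ℤ) * (N : ℤ)) (q * x) 1)
    (hrs : (p : ℤ) * s - q * r = 1)
    (ℓ ℓ' : ℕ) (ν ν' : Fin N → ℤ)
    (hℓ : ℓ ≤ N - 1) (hℓ' : ℓ' ≤ N - 1)
    (hmono : StrictMono ν) (hmono' : StrictMono ν')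
    (hrange : ν ⟨N - 1, by omega⟩ < ν ⟨0, by omega⟩ + (p : ℤ))
    (hrange' : ν' ⟨N - 1, by omega⟩ < ν' ⟨0, by omega⟩ + (p : ℤ))
    (hsum : (∑ I, ν I) = (ℓ : ℤ) * q) (hsum' : (∑ I, ν' I) = (ℓ' : ℤ) * q) :
    ∃ m : ℤ, seifertTwistCS N p q x r s ℓ ν - seifertTwistCS N p q x r s ℓ' ν' = (m : ℚ) := by
  obtain ⟨n, rfl⟩ : ∃ n, N = n + 1 := ⟨N - 1, by omega⟩
  obtain ⟨m, hm⟩ := exists_seifertTwistCS_succ_eq n p hp q x r s hpq hx hrs ℓ ν hsum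
  obtain ⟨m', hm'⟩ := exists_seifertTwistCS_succ_eq n p hp q x r s hpq hx hrs ℓ' ν' hsum'
  refine ⟨m - m', ?_⟩
  rw [hm, hm']
  push_cast
  ring
end

section
/- Let p ≥ 1 and q be integers with gcd(p,q) = 1 and q even, and let ξ, r, s be integers with (p+q)²·ξ ≡ q (mod 4p) and p·s − q·r = 1. For ℓ ∈ {0,1} and integers ν₁ < ν₂ < ν₁ + p with ν₁ + ν₂ = ℓq, set λ = ν₂ − ν₁ − 1 if ℓ = 0 and λ = p − (ν₂ − ν₁) − 1 if ℓ = 1, and define F(ℓ,ν₁,ν₂) = ξ·λ·(λ+2)/(4p) + (r/(2p))·((ν₁ − ℓq/2)² + (ν₂ − ℓq/2)²) − q·s·ℓ²/4 ∈ ℚ. Then for any two admissible data (ℓ,ν₁,ν₂) and (ℓ′,ν₁′,ν₂′), the difference F(ℓ,ν₁,ν₂) − F(ℓ′,ν₁′,ν₂′) is an integer. -/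
/-- The quantity F(ℓ,ν₁,ν₂) of STATEMENT 10:
F = ξ·λ(λ+2)/(4p) + (r/(2p))·((ν₁ − ℓq/2)² + (ν₂ − ℓq/2)²) − q·s·ℓ²/4,
where λ = ν₂ − ν₁ − 1 if ℓ = 0 and λ = p − (ν₂ − ν₁) − 1 if ℓ = 1. -/
noncomputable def seifertTwistCS2 (p : ℕ) (q ξ r s : ℤ) (ℓ : ℕ) (ν₁ ν₂ : ℤ) : ℚ :=
  let lam : ℤ := if ℓ = 0 then ν₂ - ν₁ - 1 else (p : ℤ) - (ν₂ - ν₁) - 1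
  (ξ : ℚ) * (lam : ℚ) * ((lam : ℚ) + 2) / (4 * (p : ℚ)) +
    (r : ℚ) / (2 * (p : ℚ)) *
      (((ν₁ : ℚ) - (ℓ : ℚ) * (q : ℚ) / 2) ^ 2 + ((ν₂ : ℚ) - (ℓ : ℚ) * (q : ℚ) / 2) ^ 2) -
    (q : ℚ) * (s : ℚ) * (ℓ : ℚ) ^ 2 / 4

theorem dvd_add_of_seifert {p q ξ r s : ℤ} (hξ : 4 * p ∣ q - (p + q) ^ 2 * ξ)
    (hrs : p * s - q * r = 1) : p ∣ ξ + r := by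
  have hcop : IsCoprime p q := ⟨s, -r, by linear_combination hrs⟩
  obtain ⟨c, hc⟩ := hξ
  have hsq : p ∣ q ^ 2 * (ξ + r) :=
    ⟨q * s - 4 * c - (p + 2 * q) * ξ, by linear_combination -hc - q * hrs⟩
  exact hcop.pow_right.dvd_of_dvd_mul_left hsq

theorem four_dvd_sub_of_seifert {p q ξ r s : ℤ} (hqeven : Even q)
    (hξ : 4 * p ∣ q - (p + q) ^ 2 * ξ) (hrs : p * s - q * r = 1) : 4 ∣ ξ * p - q * s := by
  obtain ⟨a, rfl⟩ := hqeven
  have hps : Odd (p * s) := ⟨a * r, by linear_combination hrs⟩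
  obtain ⟨⟨b, rfl⟩, ⟨t, rfl⟩⟩ := Int.odd_mul.1 hps
  obtain ⟨c, hc⟩ := hξ
  refine ⟨a * (b - t) - (2 * b + 1) * ((2 * b + 1) * c + (a + b) * (a + b + 1) * ξ), ?_⟩
  linear_combination -(2 * b + 1) * hc

/-- Every admissible value of `seifertTwistCS2` is congruent to `-ξ / (4p)` modulo `1`. -/
theorem exists_seifertTwistCS2_eq (p : ℕ) (hp : 1 ≤ p) (q ξ r s : ℤ) (hqeven : Even q)
    (hξ : 4 * (p : ℤ) ∣ q - ((p : ℤ) + q) ^ 2 * ξ) (hrs : (p : ℤ) * s - q * r = 1)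
    (ℓ : ℕ) (ν₁ ν₂ : ℤ) (hℓ : ℓ ≤ 1) (hsum : ν₁ + ν₂ = (ℓ : ℤ) * q) :
    ∃ m : ℤ, seifertTwistCS2 p q ξ r s ℓ ν₁ ν₂ = m - (ξ : ℚ) / (4 * p) := by
  obtain ⟨k, hk⟩ := dvd_add_of_seifert hξ hrs
  obtain ⟨n, hn⟩ := four_dvd_sub_of_seifert hqeven hξ hrs
  obtain ⟨a, rfl⟩ := hqeven
  have hp0 : (p : ℚ) ≠ 0 := by positivity
  have hr : (r : ℚ) = p * k - ξ := by
    rw [eq_sub_iff_add_eq']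
    exact_mod_cast hk
  have hnq : (ξ : ℚ) * p - (a + a) * s = 4 * n := by exact_mod_cast hn
  interval_cases ℓ
  · obtain rfl : ν₁ = -ν₂ := by linear_combination hsum
    refine ⟨k * ν₂ ^ 2, ?_⟩
    simp only [seifertTwistCS2, if_true, hr]
    push_cast
    field_simp
    ring
  · obtain rfl : ν₁ = 2 * a - ν₂ := by push_cast at hsum; linear_combination hsum
    refine ⟨n - ξ * (ν₂ - a) + k * (ν₂ - a) ^ 2, ?_⟩
    simp only [seifertTwistCS2, one_ne_zero, if_false, hr]
    push_cast
    field_simp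
    linear_combination 8 * p * hnq

/-- With gcd(p,q) = 1, q even, (p+q)²·ξ ≡ q (mod 4p) and
p·s − q·r = 1, for any two admissible data (ℓ,ν₁,ν₂) and (ℓ′,ν₁′,ν₂′)
(ℓ ∈ {0,1}, ν₁ < ν₂ < ν₁ + p, ν₁ + ν₂ = ℓq) the difference
F(ℓ,ν₁,ν₂) − F(ℓ′,ν₁′,ν₂′) is an integer. -/
theorem stmt_10 (p : ℕ) (hp : 1 ≤ p) (q ξ r s : ℤ)
    (hpq : Int.gcd (p : ℤ) q = 1) (hqeven : Even q)
    (hξ : Int.ModEq (4 * (p : ℤ)) (((p : ℤ) + q) ^ 2 * ξ) q)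
    (hrs : (p : ℤ) * s - q * r = 1)
    (ℓ ℓ' : ℕ) (ν₁ ν₂ ν₁' ν₂' : ℤ)
    (hℓ : ℓ ≤ 1) (hℓ' : ℓ' ≤ 1)
    (h₁ : ν₁ < ν₂) (h₂ : ν₂ < ν₁ + (p : ℤ))
    (h₁' : ν₁' < ν₂') (h₂' : ν₂' < ν₁' + (p : ℤ))
    (hsum : ν₁ + ν₂ = (ℓ : ℤ) * q) (hsum' : ν₁' + ν₂' = (ℓ' : ℤ) * q) :
    ∃ m : ℤ,
      seifertTwistCS2 p q ξ r s ℓ ν₁ ν₂ - seifertTwistCS2 p q ξ r s ℓ' ν₁' ν₂' = (m : ℚ) := by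
  obtain ⟨m, hm⟩ := exists_seifertTwistCS2_eq p hp q ξ r s hqeven hξ.dvd hrs ℓ ν₁ ν₂ hℓ hsum
  obtain ⟨m', hm'⟩ :=
    exists_seifertTwistCS2_eq p hp q ξ r s hqeven hξ.dvd hrs ℓ' ν₁' ν₂' hℓ' hsum'
  exact ⟨m - m', by rw [hm, hm']; push_cast; ring⟩
end

section
/- Let N be an odd positive integer. Then for every tuple of integers λ = (λ₁,…,λ_{N−1}), the integer Σ_{I,J=1}^{N−1} (N·min(I,J) − I·J)·λ_I·(λ_J + 2) is even. -/
/-- A double sum of integers that is symmetric modulo 2, with even diagonal, is even. -/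
theorem even_sum_sum_of_symm {ι : Type*} [Fintype ι] (f : ι → ι → ℤ)
    (hsymm : ∀ i j, Even (f i j + f j i)) (hdiag : ∀ i, Even (f i i)) :
    Even (∑ i, ∑ j, f i j) := by
  rw [← ZMod.intCast_eq_zero_iff_even, ← Fintype.sum_prod_type', Int.cast_sum]
  refine Finset.sum_involution (fun x _ => x.swap) (fun x _ => ?_) (fun x _ hx hswap => hx ?_)
    (fun _ _ => Finset.mem_univ _) (fun x _ => x.swap_swap)
  · exact_mod_cast ZMod.intCast_eq_zero_iff_even.mpr (hsymm x.1 x.2)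
  · have h : x.2 = x.1 := congrArg Prod.fst hswap
    rw [h]
    exact ZMod.intCast_eq_zero_iff_even.mpr (hdiag x.1)

/-- For N odd and any integers λ₁,…,λ_{N−1} (indexed here by
i : Fin (N−1) with I = i+1), the integer
Σ_{I,J=1}^{N−1} (N·min(I,J) − I·J)·λ_I·(λ_J + 2) is even. -/
theorem stmt_12 (N : ℕ) (hN : 0 < N) (hodd : Odd N) (lam : Fin (N - 1) → ℤ) :
    Even (∑ i : Fin (N - 1), ∑ j : Fin (N - 1),
      ((N : ℤ) * (min ((i : ℕ) + 1) ((j : ℕ) + 1) : ℕ) -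
        (((i : ℕ) + 1 : ℕ) : ℤ) * (((j : ℕ) + 1 : ℕ) : ℤ)) *
        lam i * (lam j + 2)) := by
  refine even_sum_sum_of_symm _ (fun i j => ?_) (fun i => ?_)
  · rw [min_comm ((j : ℕ) + 1)]
    refine ⟨((N : ℤ) * (min ((i : ℕ) + 1) ((j : ℕ) + 1) : ℕ) -
      (((i : ℕ) + 1 : ℕ) : ℤ) * (((j : ℕ) + 1 : ℕ) : ℤ)) *
      (lam i * lam j + lam i + lam j), ?_⟩
    ring
  · have h : Even ((N : ℤ) * (((i : ℕ) + 1 : ℕ) : ℤ) -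
        (((i : ℕ) + 1 : ℕ) : ℤ) * (((i : ℕ) + 1 : ℕ) : ℤ)) := by
      have hN' : Odd (N : ℤ) := by exact_mod_cast hodd
      rw [Int.even_sub, Int.even_mul, Int.even_mul, or_self,
        or_iff_right (Int.not_even_iff_odd.mpr hN')]
    rw [min_self]
    exact (h.mul_right _).mul_right _
end

section
/- Let N ≥ 1, p ≥ 1, q, and ℓ be integers, and ν = (ν₁,…,ν_N) ∈ ℤ^N with Σ_I ν_I = ℓq. For a pair of integers (r,s) with p·s − q·r = 1 define CS(r,s) = (p·r/2)·Σ_{I=1}^{N} ((ν_I − ℓq/N)/p)² − (q·s/2)·(N−1)·ℓ²/N ∈ ℚ. Then for any two pairs (r,s) and (r′,s′) both satisfying p·s − q·r = 1 = p·s′ − q·r′, the difference CS(r,s) − CS(r′,s′) is an integer. -/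
theorem even_sum_sq_sub_sq_sum {ι : Type*} (t : Finset ι) (f : ι → ℤ) :
    Even (∑ i ∈ t, f i ^ 2 - (∑ i ∈ t, f i) ^ 2) := by
  have h_even (n : ℤ) : Even (n ^ 2 - n) := by
    simpa [sq, mul_sub] using Int.even_mul_pred_self n
  have h_sum : Even (∑ i ∈ t, f i ^ 2 - ∑ i ∈ t, f i) := by
    rw [← Finset.sum_sub_distrib]
    exact Finset.even_sum _ fun i _ => h_even (f i)
  have h := h_sum.sub (h_even (∑ i ∈ t, f i))
  rwa [sub_sub_sub_cancel_right] at h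

theorem sum_sub_mean_sq {ι K : Type*} [Fintype ι] [Field K] (f : ι → K)
    (hι : (Fintype.card ι : K) ≠ 0) :
    ∑ i, (f i - (∑ j, f j) / Fintype.card ι) ^ 2 =
      ∑ i, f i ^ 2 - (∑ i, f i) ^ 2 / Fintype.card ι := by
  simp only [sub_sq, Finset.sum_add_distrib, Finset.sum_sub_distrib, ← Finset.sum_mul,
    ← Finset.mul_sum, Finset.sum_const, Finset.card_univ, nsmul_eq_mul]
  field_simp
  ring

/-- The Chern–Simons contribution
CS(r,s) = (p·r/2)·Σ_I ((ν_I − ℓq/N)/p)² − (q·s/2)·(N−1)·ℓ²/N of a Seifert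
fiber is well defined modulo ℤ, independently of the choice of integers r,s
with p·s − q·r = 1. -/
theorem stmt_13 (N p : ℕ) (hN : 1 ≤ N) (hp : 1 ≤ p) (q ℓ : ℤ) (ν : Fin N → ℤ)
    (hsum : (∑ I, ν I) = ℓ * q) (r s r' s' : ℤ)
    (hrs : (p : ℤ) * s - q * r = 1) (hrs' : (p : ℤ) * s' - q * r' = 1) :
    ∃ m : ℤ,
      (((p : ℚ) * (r : ℚ) / 2) * (∑ I : Fin N, (((ν I : ℚ) - (ℓ : ℚ) * (q : ℚ) / (N : ℚ)) / (p : ℚ)) ^ 2)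
          - ((q : ℚ) * (s : ℚ) / 2) * ((N : ℚ) - 1) * (ℓ : ℚ) ^ 2 / (N : ℚ))
        - (((p : ℚ) * (r' : ℚ) / 2) * (∑ I : Fin N, (((ν I : ℚ) - (ℓ : ℚ) * (q : ℚ) / (N : ℚ)) / (p : ℚ)) ^ 2)
          - ((q : ℚ) * (s' : ℚ) / 2) * ((N : ℚ) - 1) * (ℓ : ℚ) ^ 2 / (N : ℚ))
      = (m : ℚ) := by
  obtain ⟨c, hc⟩ := even_sum_sq_sub_sq_sum Finset.univ ν
  rw [hsum] at hc
  have hN0 : (N : ℚ) ≠ 0 := by positivity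
  have hp0 : (p : ℚ) ≠ 0 := by positivity
  have hsumQ : ∑ I, (ν I : ℚ) = ℓ * q := by exact_mod_cast hsum
  have hcQ : ∑ I, (ν I : ℚ) ^ 2 = c + c + (ℓ * q) ^ 2 := by
    have h := sub_eq_iff_eq_add.mp hc
    exact_mod_cast h
  have h_sq := sum_sub_mean_sq (fun I => (ν I : ℚ)) (by simpa using hN0)
  simp only [Fintype.card_fin, hsumQ, hcQ] at h_sq
  obtain ⟨k, hr, hs⟩ : ∃ k : ℤ, r = r' + p * k ∧ s = s' + q * k :=
    ⟨r * s' - s * r', by linear_combination r' * hrs - r * hrs',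
      by linear_combination s' * hrs - s * hrs'⟩
  refine ⟨k * c, ?_⟩
  simp only [div_pow, ← Finset.sum_div, h_sq]
  subst hr hs
  push_cast
  field_simp
  ring
end

section
/- Let n ≥ 3 and let (p_i, q_i), i = 1,…,n, be pairs of integers with gcd(p_i, q_i) = 1 for all i. Then there exist integers m₁,…,mₙ with m₁ + ⋯ + mₙ = 0 such that for every i, 3 does not divide q_i + p_i·m_i. -/
/-- At most one residue class of `a` modulo 3 makes `q + p * a` divisible by 3. -/
lemma exists_three_dvd_sub_of_three_dvd_add_mul {p q : ℤ} (h : Int.gcd p q = 1) :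
    ∃ r : ℤ, ∀ a : ℤ, (3 : ℤ) ∣ q + p * a → (3 : ℤ) ∣ a - r := by
  by_cases hp : (3 : ℤ) ∣ p
  · refine ⟨0, fun a ha => ?_⟩
    have hq : (3 : ℤ) ∣ q := (dvd_add_left (hp.mul_right a)).mp ha
    have h3 : (3 : ℤ) ∣ (Int.gcd p q : ℤ) := Int.dvd_coe_gcd hp hq
    rw [h] at h3
    omega
  · have hsq : (3 : ℤ) ∣ p * p - 1 := by
      obtain h1 | h1 : (3 : ℤ) ∣ p - 1 ∨ (3 : ℤ) ∣ p + 1 := by omega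
      · exact (h1.mul_right (p + 1)).trans (dvd_of_eq (by ring))
      · exact (h1.mul_right (p - 1)).trans (dvd_of_eq (by ring))
    refine ⟨-(p * q), fun a ha => ?_⟩
    exact (dvd_sub (ha.mul_left p) (hsq.mul_right a)).trans (dvd_of_eq (by ring))

lemma exists_not_three_dvd_pair {p q p' q' : ℤ} (h : Int.gcd p q = 1)
    (h' : Int.gcd p' q' = 1) (s : ℤ) :
    ∃ a : ℤ, ¬ (3 : ℤ) ∣ q + p * a ∧ ¬ (3 : ℤ) ∣ q' + p' * (s - a) := by
  obtain ⟨r, hr⟩ := exists_three_dvd_sub_of_three_dvd_add_mul h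
  obtain ⟨r', hr'⟩ := exists_three_dvd_sub_of_three_dvd_add_mul h'
  obtain ⟨a, ha, ha'⟩ : ∃ a : ℤ, ¬ (3 : ℤ) ∣ a - r ∧ ¬ (3 : ℤ) ∣ s - a - r' := by
    by_cases h0 : ¬ (3 : ℤ) ∣ 0 - r ∧ ¬ (3 : ℤ) ∣ s - 0 - r'
    · exact ⟨0, h0⟩
    by_cases h1 : ¬ (3 : ℤ) ∣ 1 - r ∧ ¬ (3 : ℤ) ∣ s - 1 - r'
    · exact ⟨1, h1⟩
    exact ⟨2, by omega, by omega⟩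
  exact ⟨a, fun hd => ha (hr a hd), fun hd => ha' (hr' _ hd)⟩

/-- For n ≥ 3 and Seifert data (p_i, q_i) with gcd(p_i,q_i) = 1,
there is a gauge transformation m with Σ m_i = 0 making every q_i + p_i·m_i
coprime to 3. -/
theorem stmt_16 (n : ℕ) (hn : 3 ≤ n) (p q : Fin n → ℤ)
    (hco : ∀ i, Int.gcd (p i) (q i) = 1) :
    ∃ m : Fin n → ℤ, (∑ i, m i) = 0 ∧ ∀ i, ¬ ((3 : ℤ) ∣ q i + p i * m i) := by
  obtain ⟨k, rfl⟩ : ∃ k, n = k + 2 := ⟨n - 2, by omega⟩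
  choose f hf _ using fun i => exists_not_three_dvd_pair (hco i) (hco i) 0
  obtain ⟨a, ha, ha'⟩ :=
    exists_not_three_dvd_pair (hco 0) (hco 1) (-∑ i : Fin k, f i.succ.succ)
  refine ⟨Fin.cons a (Fin.cons (-∑ i : Fin k, f i.succ.succ - a)
    fun i => f i.succ.succ), ?_, ?_⟩
  · simp only [Fin.sum_univ_succ, Fin.cons_zero, Fin.cons_succ]
    ring
  · refine Fin.cases ?_ (Fin.cases ?_ fun i => ?_)
    · simpa using ha
    · simpa using ha'
    · simpa using hf i.succ.succ
end
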